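/- Let (X,d) be a compact metric space and φ : X → X a homeomorphism. Suppose that a map [·,·], defined and continuous on {(x,y) ∈ X × X : d(x,y) ≤ ε} for some ε > 0, together with a constant 0 < λ < 1, satisfies the Smale space axioms B1–B4, C1, C2 for (X,φ), and that [·,·]′ (defined for d(x,y) ≤ ε′, with constant 0 < λ′ < 1) also satisfies these axioms. Then there exists δ > 0 such that [x,y] = [x,y]′ for all x, y ∈ X with d(x,y) ≤ δ. (The bracket map of a Smale space is unique.) -/

import Mathlib

/-- A Smale space bracket on a compact metric space `X` with homeomorphism `φ`:
a constant `ε > 0`, a constant `0 < λ < 1`, and a map `[·,·]` (here a total map whose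
relevant values are those on `{(x,y) | dist x y ≤ ε}`, on which it is continuous),
satisfying the Smale space axioms B1–B4, C1, C2 (each axiom is imposed whenever
both sides are defined, i.e. whenever the relevant distance conditions hold). -/
structure SmaleBracket (X : Type*) [MetricSpace X] (φ : X ≃ₜ X) where
  eps : ℝ
  eps_pos : 0 < eps
  lam : ℝ
  lam_pos : 0 < lam
  lam_lt_one : lam < 1
  br : X → X → X
  continuousOn : ContinuousOn (fun p : X × X => br p.1 p.2) {p : X × X | dist p.1 p.2 ≤ eps}
  B1 : ∀ x : X, br x x = x
  B2 : ∀ x y z : X, dist y z ≤ eps → dist x (br y z) ≤ eps → dist x z ≤ eps →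
    br x (br y z) = br x z
  B3 : ∀ x y z : X, dist x y ≤ eps → dist (br x y) z ≤ eps → dist x z ≤ eps →
    br (br x y) z = br x z
  B4 : ∀ x y : X, dist x y ≤ eps → dist (φ x) (φ y) ≤ eps →
    φ (br x y) = br (φ x) (φ y)
  C1 : ∀ x y : X, dist x y ≤ eps → br x y = y → dist (φ x) (φ y) ≤ lam * dist x y
  C2 : ∀ x y : X, dist x y ≤ eps → br x y = x →
    dist (φ.symm x) (φ.symm y) ≤ lam * dist x y

namespace SmaleBracket

variable {X : Type*} [MetricSpace X] {φ : X ≃ₜ X}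

/-- Exchanging the two arguments of the bracket gives a bracket for the inverse map. -/
def dual (B : SmaleBracket X φ) : SmaleBracket X φ.symm where
  eps := B.eps
  eps_pos := B.eps_pos
  lam := B.lam
  lam_pos := B.lam_pos
  lam_lt_one := B.lam_lt_one
  br x y := B.br y x
  continuousOn := B.continuousOn.comp continuous_swap.continuousOn fun p hp => by
    simpa [dist_comm] using hp
  B1 := B.B1
  B2 x y z h₁ h₂ h₃ :=
    B.B3 z y x (by rwa [dist_comm]) (by rwa [dist_comm]) (by rwa [dist_comm])
  B3 x y z h₁ h₂ h₃ :=
    B.B2 z y x (by rwa [dist_comm]) (by rwa [dist_comm]) (by rwa [dist_comm])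
  B4 x y h₁ h₂ := by
    rw [Homeomorph.symm_apply_eq, B.B4 _ _ (by rwa [dist_comm]) (by simpa [dist_comm] using h₁)]
    simp
  C1 x y h e := by
    rw [dist_comm, dist_comm x]
    exact B.C2 y x (by rwa [dist_comm]) e
  C2 x y h e := by
    rw [dist_comm, dist_comm x]
    exact B.C1 y x (by rwa [dist_comm]) e

theorem exists_dist_br_le [CompactSpace X] (B : SmaleBracket X φ) {η : ℝ} (hη : 0 < η) :
    ∃ δ : ℝ, 0 < δ ∧ δ ≤ B.eps ∧ ∀ x y : X, dist x y ≤ δ →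
      dist x (B.br x y) ≤ η ∧ dist y (B.br x y) ≤ η := by
  have hK : IsCompact {p : X × X | dist p.1 p.2 ≤ B.eps} :=
    (isClosed_le continuous_dist continuous_const).isCompact
  have hu := hK.uniformContinuousOn_of_continuous B.continuousOn
  obtain ⟨δ, hδ, h⟩ := Metric.uniformContinuousOn_iff.1 hu η hη
  refine ⟨min (δ / 2) B.eps, lt_min (half_pos hδ) B.eps_pos, min_le_right _ _,
    fun x y hxy => ?_⟩
  obtain ⟨h₁, h₂⟩ := le_min_iff.1 hxy
  have hlt : dist x y < δ := by linarith
  have hx := h (x, x) (by simpa using B.eps_pos.le) (x, y) h₂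
    (by simpa [Prod.dist_eq] using hlt)
  have hy := h (y, y) (by simpa using B.eps_pos.le) (x, y) h₂
    (by simpa [Prod.dist_eq, dist_comm] using hlt)
  simp only [B.B1] at hx hy
  exact ⟨hx.le, hy.le⟩

theorem dist_iterate_le (B : SmaleBracket X φ) {x z : X} (h : dist x z ≤ B.eps)
    (e : B.br x z = z) (n : ℕ) : dist (φ^[n] x) (φ^[n] z) ≤ dist x z := by
  induction n generalizing x z with
  | zero => simp
  | succ n ih =>
    have h₁ : dist (φ x) (φ z) ≤ dist x z :=
      (B.C1 x z h e).trans (mul_le_of_le_one_left dist_nonneg B.lam_lt_one.le)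
    have h₂ := h₁.trans h
    simp only [Function.iterate_succ_apply]
    exact (ih h₂ (by rw [← B.B4 x z h h₂, e])).trans h₁

theorem dist_iterate_br_le (B : SmaleBracket X φ) {x y : X} (h : dist x y ≤ B.eps)
    (h' : dist x (B.br x y) ≤ B.eps) (n : ℕ) :
    dist (φ^[n] x) (φ^[n] (B.br x y)) ≤ dist x (B.br x y) :=
  B.dist_iterate_le h' (B.B2 x x y h h' h) n

/-- If the backward orbits of two points stay close, their bracket is the first point. -/
theorem br_eq_left_of_backward_close (B : SmaleBracket X φ) {δ : ℝ} (hδ : δ ≤ B.eps)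
    (hbr : ∀ x y : X, dist x y ≤ δ → dist x (B.br x y) ≤ B.eps) {z z' : X}
    (h : ∀ n, dist (φ.symm^[n] z) (φ.symm^[n] z') ≤ δ) : B.br z z' = z := by
  have key : ∀ n : ℕ, ∀ z z' : X, (∀ n, dist (φ.symm^[n] z) (φ.symm^[n] z') ≤ δ) →
      dist z (B.br z z') ≤ B.lam ^ n * B.eps := by
    intro n
    induction n with
    | zero => intro z z' h; simpa using hbr z z' (h 0)
    | succ n ih =>
      intro z z' h
      have h₀ : dist z z' ≤ B.eps := (h 0).trans hδ
      have h₁ : dist (φ.symm z) (φ.symm z') ≤ δ := h 1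
      have hs := hbr _ _ h₁
      have hc := B.C1 _ _ hs (B.B2 _ _ _ (h₁.trans hδ) hs (h₁.trans hδ))
      rw [B.B4 _ _ (h₁.trans hδ) (by simpa using h₀)] at hc
      simp only [Homeomorph.apply_symm_apply] at hc
      calc dist z (B.br z z') ≤ _ := hc
        _ ≤ B.lam * (B.lam ^ n * B.eps) :=
          mul_le_mul_of_nonneg_left
            (ih _ _ fun k => by simpa only [Function.iterate_succ_apply] using h (k + 1))
            B.lam_pos.le
        _ = B.lam ^ (n + 1) * B.eps := by ring
  have hlim : Filter.Tendsto (fun n : ℕ => B.lam ^ n * B.eps) Filter.atTop (nhds 0) := by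
    simpa using (tendsto_pow_atTop_nhds_zero_of_lt_one B.lam_pos.le B.lam_lt_one).mul_const B.eps
  exact (dist_le_zero.1 (ge_of_tendsto' hlim fun n => key n z z' h)).symm

/-- Expansiveness: two points whose full orbits stay close coincide. -/
theorem eq_of_orbits_close (B : SmaleBracket X φ) {δ : ℝ} (hδ : δ ≤ B.eps)
    (hbr : ∀ x y : X, dist x y ≤ δ → dist x (B.br x y) ≤ B.eps ∧ dist y (B.br x y) ≤ B.eps)
    {z z' : X} (hf : ∀ n, dist (φ^[n] z) (φ^[n] z') ≤ δ)
    (hb : ∀ n, dist (φ.symm^[n] z) (φ.symm^[n] z') ≤ δ) : z = z' := by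
  have h₁ : B.br z z' = z :=
    B.br_eq_left_of_backward_close hδ (fun x y h => (hbr x y h).1) hb
  have h₂ : B.br z z' = z' :=
    B.dual.br_eq_left_of_backward_close hδ
      (fun x y h => (hbr y x (by rwa [dist_comm])).2)
      (fun n => by rw [dist_comm]; exact hf n)
  exact h₁.symm.trans h₂

end SmaleBracket

/-- The bracket map of a Smale space is unique: if `[·,·]` (with constants `ε, λ`) and
`[·,·]′` (with constants `ε′, λ′`) both satisfy the Smale space axioms for the same
compact metric space `X` and homeomorphism `φ`, then there is `δ > 0` such that
`[x,y] = [x,y]′` whenever `d(x,y) ≤ δ`. -/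
theorem smaleBracket_unique {X : Type*} [MetricSpace X] [CompactSpace X] (φ : X ≃ₜ X)
    (B B' : SmaleBracket X φ) :
    ∃ δ : ℝ, 0 < δ ∧ ∀ x y : X, dist x y ≤ δ → B.br x y = B'.br x y := by
  obtain ⟨δ₀, hδ₀, hδ₀B, hbr⟩ := B.exists_dist_br_le B.eps_pos
  have close (C : SmaleBracket X φ) : ∃ δ : ℝ, 0 < δ ∧ ∀ x y : X, dist x y ≤ δ →
      ∀ n, dist (φ^[n] x) (φ^[n] (C.br x y)) ≤ δ₀ / 2 ∧
        dist (φ.symm^[n] y) (φ.symm^[n] (C.br x y)) ≤ δ₀ / 2 := by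
    obtain ⟨δ, hδ, hδC, h⟩ := C.exists_dist_br_le (lt_min C.eps_pos (half_pos hδ₀))
    refine ⟨δ, hδ, fun x y hxy n => ?_⟩
    obtain ⟨hx, hy⟩ := h x y hxy
    rw [le_min_iff] at hx hy
    have hxy' := hxy.trans hδC
    exact ⟨(C.dist_iterate_br_le hxy' hx.1 n).trans hx.2,
      (C.dual.dist_iterate_br_le (x := y) (y := x) (by rwa [dist_comm]) hy.1 n).trans hy.2⟩
  obtain ⟨δ, hδ, h⟩ := close B
  obtain ⟨δ', hδ', h'⟩ := close B'
  refine ⟨min δ δ', lt_min hδ hδ', fun x y hxy => ?_⟩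
  rw [le_min_iff] at hxy
  refine B.eq_of_orbits_close hδ₀B hbr (fun n => ?_) (fun n => ?_)
  · have h₁ := (h x y hxy.1 n).1
    have h₂ := (h' x y hxy.2 n).1
    exact (dist_triangle_left _ _ (φ^[n] x)).trans (by linarith)
  · have h₁ := (h x y hxy.1 n).2
    have h₂ := (h' x y hxy.2 n).2
    exact (dist_triangle_left _ _ (φ.symm^[n] y)).trans (by linarith)
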